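/- Fix integers m ≥ 1, n ≥ 1 and reals ν > 0, σ² > 0, ρ² > 0. For every x^n = (x_1,…,x_n) ∈ (ℝ^m)^n, the determinants of the MAP covariance estimates satisfy |Σ̄_n| = ((ν+n−1)/(ν+n))^m · |Σ̄_{n−1}| · (1 + c_{n−1}·(x_n−μ̄_{n−1})ᵀ Σ̄_{n−1}⁻¹ (x_n−μ̄_{n−1})), where c_k = (ρ²ν+k)/((ν+k)(ρ²ν+k+1)) and Σ̄_{n−1}, μ̄_{n−1} are computed from the first n−1 observations. -/

import Mathlib

open MeasureTheory Matrix Real BigOperators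

/-- Likelihood of `n` observations under the `m`-dimensional normal distribution
with mean `μ` and covariance `S`. -/
noncomputable def mvnLik (m n : ℕ) (x : Fin n → Fin m → ℝ) (μ : Fin m → ℝ)
    (S : Matrix (Fin m) (Fin m) ℝ) : ℝ :=
  ∏ i : Fin n, (2 * π) ^ (-(m : ℝ) / 2) * S.det ^ (-(1 : ℝ) / 2) *
    Real.exp (-(1 / 2) * ((x i - μ) ⬝ᵥ (S⁻¹ *ᵥ (x i - μ))))

/-- The simple luckiness function `π(μ, Σ; ν, σ², ρ²)`. -/
noncomputable def luck (m : ℕ) (μ : Fin m → ℝ) (S : Matrix (Fin m) (Fin m) ℝ)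
    (ν σ2 ρ2 : ℝ) : ℝ :=
  (2 * π) ^ (-(m : ℝ) * ν / 2) * S.det ^ (-ν / 2) *
    Real.exp (-(ν / 2) *
      (S⁻¹ * (σ2 • (1 : Matrix (Fin m) (Fin m) ℝ) + ρ2 • vecMulVec μ μ)).trace)

/-- The generalized luckiness function `π(μ, Σ; ν, μ₀, Σ₀, ρ²)`. -/
noncomputable def luck2 (m : ℕ) (μ : Fin m → ℝ) (S : Matrix (Fin m) (Fin m) ℝ)
    (ν : ℝ) (μ0 : Fin m → ℝ) (S0 : Matrix (Fin m) (Fin m) ℝ) (ρ2 : ℝ) : ℝ :=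
  (2 * π) ^ (-(m : ℝ) * ν / 2) * S.det ^ (-ν / 2) *
    Real.exp (-(ν / 2) *
      (S⁻¹ * (S0 + ρ2 • vecMulVec (μ - μ0) (μ - μ0))).trace)

/-- MAP location estimate `μ̄_k` for the simple luckiness. -/
noncomputable def muBar (m k : ℕ) (ν ρ2 : ℝ) (x : Fin k → Fin m → ℝ) : Fin m → ℝ :=
  (1 / (k + ρ2 * ν)) • ∑ i : Fin k, x i

/-- MAP covariance estimate `Σ̄_k` for the simple luckiness. -/
noncomputable def sigmaBar (m k : ℕ) (ν σ2 ρ2 : ℝ) (x : Fin k → Fin m → ℝ) :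
    Matrix (Fin m) (Fin m) ℝ :=
  (1 / (k + ν)) •
      (∑ i : Fin k, vecMulVec (x i) (x i) + (ν * σ2) • (1 : Matrix (Fin m) (Fin m) ℝ))
    - (1 / ((ν + k) * (ρ2 * ν + k))) • ∑ i : Fin k, ∑ j : Fin k, vecMulVec (x i) (x j)

/-- MAP location estimate `μ̄_k` for the generalized luckiness. -/
noncomputable def muBar2 (m k : ℕ) (ν ρ2 : ℝ) (μ0 : Fin m → ℝ)
    (x : Fin k → Fin m → ℝ) : Fin m → ℝ :=
  μ0 + (1 / (k + ρ2 * ν)) • ∑ i : Fin k, (x i - μ0)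

/-- MAP covariance estimate `Σ̄_k` for the generalized luckiness. -/
noncomputable def sigmaBar2 (m k : ℕ) (ν ρ2 : ℝ) (μ0 : Fin m → ℝ)
    (S0 : Matrix (Fin m) (Fin m) ℝ) (x : Fin k → Fin m → ℝ) : Matrix (Fin m) (Fin m) ℝ :=
  (1 / (k + ν)) • (∑ i : Fin k, vecMulVec (x i - μ0) (x i - μ0) + ν • S0)
    - (1 / ((ν + k) * (ρ2 * ν + k))) •
        ∑ i : Fin k, ∑ j : Fin k, vecMulVec (x i - μ0) (x j - μ0)

/-- The multivariate gamma function `Γ_m(z)`. -/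
noncomputable def multiGamma (m : ℕ) (z : ℝ) : ℝ :=
  π ^ ((m : ℝ) * ((m : ℝ) - 1) / 4) * ∏ j : Fin m, Real.Gamma (z - (j : ℝ) / 2)

/-- The capacity `𝒞(m, n, ν, σ², ρ²)` (note: the fourth argument is `σ²`,
so `σ^{-mν} = (σ²)^{-mν/2}`). -/
noncomputable def capC (m n : ℕ) (ν σ2 ρ2 : ℝ) : ℝ :=
  σ2 ^ (-(m : ℝ) * ν / 2) *
    ((((n : ℝ) + ν) ^ ((n : ℝ) + ν) * (1 + n / (ρ2 * ν))) /
        ((2 * Real.exp 1) ^ ((n : ℝ) + ν) * (π * ν) ^ ν)) ^ ((m : ℝ) / 2) *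
    (multiGamma m (ν / 2) / multiGamma m (((n : ℝ) + ν) / 2))

/-- The pointwise supremum of likelihood times simple luckiness over all `μ`
and positive definite `Σ`. -/
noncomputable def supLik (m n : ℕ) (ν σ2 ρ2 : ℝ) (x : Fin n → Fin m → ℝ) : ℝ :=
  ⨆ p : (Fin m → ℝ) × {S : Matrix (Fin m) (Fin m) ℝ // S.PosDef},
    mvnLik m n x p.1 p.2.1 * luck m p.1 p.2.1 ν σ2 ρ2

/-- The pointwise supremum of likelihood times generalized luckiness over all `μ`
and positive definite `Σ`. -/
noncomputable def supLik2 (m n : ℕ) (ν : ℝ) (μ0 : Fin m → ℝ)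
    (S0 : Matrix (Fin m) (Fin m) ℝ) (ρ2 : ℝ) (x : Fin n → Fin m → ℝ) : ℝ :=
  ⨆ p : (Fin m → ℝ) × {S : Matrix (Fin m) (Fin m) ℝ // S.PosDef},
    mvnLik m n x p.1 p.2.1 * luck2 m p.1 p.2.1 ν μ0 S0 ρ2

/-- The density of the `m`-variate Student t-distribution with `d` degrees of
freedom, location `μ` and scale matrix `S`. -/
noncomputable def tDens (m : ℕ) (d : ℝ) (x μ : Fin m → ℝ)
    (S : Matrix (Fin m) (Fin m) ℝ) : ℝ :=
  Real.Gamma ((d + m) / 2) /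
      (Real.Gamma (d / 2) * (d * π) ^ ((m : ℝ) / 2) * S.det ^ ((1 : ℝ) / 2)) *
    (1 + (1 / d) * ((x - μ) ⬝ᵥ (S⁻¹ *ᵥ (x - μ)))) ^ (-(d + (m : ℝ)) / 2)

/-- The double sum of outer products is the outer product of the sums. -/
theorem sum_sum_vecMulVec {m k : ℕ} (x : Fin k → Fin m → ℝ) :
    ∑ i : Fin k, ∑ j : Fin k, vecMulVec (x i) (x j) =
      vecMulVec (∑ i : Fin k, x i) (∑ i : Fin k, x i) := by
  ext a b
  simp [Matrix.sum_apply, vecMulVec_apply, Finset.sum_apply, Finset.sum_mul_sum]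

/-- Rank-one update formula for the MAP covariance estimates. -/
theorem sigmaBar_succ (m k : ℕ) {ν ρ2 : ℝ} (σ2 : ℝ) (hν : 0 < ν) (hρ : 0 < ρ2)
    (x : Fin (k + 1) → Fin m → ℝ) :
    sigmaBar m (k + 1) ν σ2 ρ2 x =
      ((ν + k) / (ν + k + 1)) •
        (sigmaBar m k ν σ2 ρ2 (fun i => x i.castSucc) +
          ((ρ2 * ν + k) / ((ν + k) * (ρ2 * ν + k + 1))) •
            vecMulVec (x (Fin.last k) - muBar m k ν ρ2 (fun i => x i.castSucc))
              (x (Fin.last k) - muBar m k ν ρ2 (fun i => x i.castSucc))) := by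
  have h₁ : (k : ℝ) + ν ≠ 0 := by positivity
  have h₂ : (k : ℝ) + 1 + ν ≠ 0 := by positivity
  have h₃ : (k : ℝ) + ρ2 * ν ≠ 0 := by positivity
  have h₄ : (k : ℝ) + 1 + ρ2 * ν ≠ 0 := by positivity
  simp only [sigmaBar, muBar, sum_sum_vecMulVec]
  simp only [Fin.sum_univ_castSucc]
  generalize ∑ i : Fin k, x i.castSucc = s
  generalize ∑ i : Fin k, vecMulVec (x i.castSucc) (x i.castSucc) = t
  ext a b
  simp only [Matrix.add_apply, Matrix.sub_apply, Matrix.smul_apply, vecMulVec_apply,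
    Pi.add_apply, Pi.sub_apply, Pi.smul_apply, smul_eq_mul, Nat.cast_add, Nat.cast_one]
  rw [show ν + (k : ℝ) + 1 = k + 1 + ν by ring, show ν + ((k : ℝ) + 1) = k + 1 + ν by ring,
    show ρ2 * ν + (k : ℝ) + 1 = k + 1 + ρ2 * ν by ring,
    show ρ2 * ν + ((k : ℝ) + 1) = k + 1 + ρ2 * ν by ring,
    add_comm ν, add_comm (ρ2 * ν)]
  field_simp
  ring

theorem sigmaBar_posDef (m k : ℕ) {ν σ2 ρ2 : ℝ} (hν : 0 < ν) (hσ : 0 < σ2) (hρ : 0 < ρ2)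
    (x : Fin k → Fin m → ℝ) : (sigmaBar m k ν σ2 ρ2 x).PosDef := by
  induction k with
  | zero =>
    have h : sigmaBar m 0 ν σ2 ρ2 x = σ2 • (1 : Matrix (Fin m) (Fin m) ℝ) := by
      simp [sigmaBar, smul_smul, hν.ne']
    rw [h]
    exact PosDef.one.smul hσ
  | succ k ih =>
    rw [sigmaBar_succ m k σ2 hν hρ]
    refine ((ih _).add_posSemidef (PosSemidef.smul ?_ ?_)).smul ?_
    · simpa using posSemidef_vecMulVec_self_star
        (x (Fin.last k) - muBar m k ν ρ2 (fun i => x i.castSucc))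
    · positivity
    · positivity

/-- The matrix determinant lemma for a symmetric rank-one update. -/
theorem det_add_smul_vecMulVec {m : ℕ} {A : Matrix (Fin m) (Fin m) ℝ} (hA : IsUnit A.det)
    (c : ℝ) (u : Fin m → ℝ) :
    (A + c • vecMulVec u u).det = A.det * (1 + c * (u ⬝ᵥ (A⁻¹ *ᵥ u))) := by
  rw [← smul_vecMulVec, vecMulVec_eq Unit, det_add_replicateCol_mul_replicateRow hA,
    Matrix.mul_assoc, ← replicateCol_mulVec, mulVec_smul]
  simp

/-- recursion for the determinants of the MAP covariance estimates,
with `c_k = (ρ²ν+k)/((ν+k)(ρ²ν+k+1))` evaluated at `k = n-1`. -/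
theorem sigmaBar_det_recursion (m n : ℕ) (hm : 1 ≤ m) (hn : 1 ≤ n) (ν σ2 ρ2 : ℝ)
    (hν : 0 < ν) (hσ : 0 < σ2) (hρ : 0 < ρ2)
    (x : Fin n → Fin m → ℝ) :
    (sigmaBar m n ν σ2 ρ2 x).det =
      ((ν + n - 1) / (ν + n)) ^ m *
        (sigmaBar m (n - 1) ν σ2 ρ2 (fun i => x (Fin.castLE (Nat.sub_le n 1) i))).det *
        (1 + ((ρ2 * ν + n - 1) / ((ν + n - 1) * (ρ2 * ν + n))) *
          ((x ⟨n - 1, by omega⟩ -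
              muBar m (n - 1) ν ρ2 (fun i => x (Fin.castLE (Nat.sub_le n 1) i))) ⬝ᵥ
            ((sigmaBar m (n - 1) ν σ2 ρ2 (fun i => x (Fin.castLE (Nat.sub_le n 1) i)))⁻¹ *ᵥ
              (x ⟨n - 1, by omega⟩ -
                muBar m (n - 1) ν ρ2 (fun i => x (Fin.castLE (Nat.sub_le n 1) i)))))) := by
  obtain ⟨k, rfl⟩ := Nat.exists_eq_add_of_le' hn
  have key := congrArg Matrix.det (sigmaBar_succ m k σ2 hν hρ x)
  rw [det_smul, Fintype.card_fin, det_add_smul_vecMulVec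
    (sigmaBar_posDef m k hν hσ hρ _).det_pos.ne'.isUnit, ← mul_assoc] at key
  have h₁ : ν + ((k + 1 : ℕ) : ℝ) = ν + k + 1 := by push_cast; ring
  have h₂ : ρ2 * ν + ((k + 1 : ℕ) : ℝ) = ρ2 * ν + k + 1 := by push_cast; ring
  rw [h₁, h₂, add_sub_cancel_right, add_sub_cancel_right]
  exact key
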